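/- Let A be a dg algebra over a field k of characteristic zero and M an acyclic dg A-A-bimodule. If M is pointwisely nilpotent, then HH_⊕^•(A,M) = 0, i.e. the sum Hochschild cochain complex (Hoch_⊕^•(A,M), d_H + ∂) is acyclic. -/

import Mathlib

set_option maxHeartbeats 1000000
set_option synthInstance.maxHeartbeats 400000
set_option linter.unusedVariables false

noncomputable section

namespace KD

open scoped BigOperators TensorProduct

variable (k : Type) [Field k]

def ε (n : ℤ) : k := if Even n then 1 else -1

def ext0 {X : Type} [Zero X] {n : ℕ} (a : Fin n → X) (m : ℕ) : X :=
  if h : m < n then a ⟨m, h⟩ else 0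

def compAtF {X : Type} [Zero X] (p₁ p₂ : ℤ)
    (f : (Fin p₁.toNat → X) → X) (g : (Fin p₂.toNat → X) → X)
    (i : ℕ) (a : Fin (p₁ + p₂ - 1).toNat → X) : X :=
  f (fun j => if (j : ℕ) < i then ext0 a (j : ℕ)
      else if (j : ℕ) = i then g (fun l => ext0 a (i + (l : ℕ)))
      else ext0 a ((j : ℕ) + p₂.toNat - 1))

structure DGAlgebra (A : Type) [Ring A] [Algebra k A] : Type where
  gr : ℤ → Submodule k A
  one_mem : (1 : A) ∈ gr 0
  mul_mem : ∀ {i j : ℤ} {a b : A}, a ∈ gr i → b ∈ gr j → a * b ∈ gr (i + j)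
  isInternal : DirectSum.IsInternal gr
  d : A →ₗ[k] A
  d_sq : ∀ a, d (d a) = 0
  d_mem : ∀ {i : ℤ} {a : A}, a ∈ gr i → d a ∈ gr (i + 1)
  d_leibniz : ∀ {i : ℤ} (a b : A), a ∈ gr i → d (a * b) = d a * b + ε k i • (a * d b)

variable {A : Type} [Ring A] [Algebra k A]

abbrev Coch (A : Type) [Ring A] [Algebra k A] (p : ℤ) : Type :=
  MultilinearMap k (fun _ : Fin p.toNat => A) A

def cochCast {p q : ℤ} (h : p = q) (f : Coch k A p) : Coch k A q :=
  f.domDomCongr (finCongr (congrArg Int.toNat h))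

def IsHomog (R : DGAlgebra k A) (p r : ℤ) (f : Coch k A p) : Prop :=
  ∀ (dg : ℕ → ℤ) (a : ℕ → A), (∀ i, a i ∈ R.gr (dg i)) →
    f (fun i => a (i : ℕ)) ∈ R.gr ((∑ i : Fin p.toNat, dg (i : ℕ)) + r)

/-- The family `dH` is the Hochschild differential of `(A, d_A)`. -/
def IsHochDiff (R : DGAlgebra k A)
    (dH : ∀ p r : ℤ, Coch k A p →ₗ[k] Coch k A (p + 1)) : Prop :=
  ∀ (p : ℤ), 0 ≤ p → ∀ (r : ℤ) (f : Coch k A p) (dg : ℕ → ℤ) (a : ℕ → A),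
    (∀ i, a i ∈ R.gr (dg i)) →
    dH p r f (fun i => a (i : ℕ)) =
      ε k (p + r - 1 + r * dg 0) • (a 0 * f (fun i => a ((i : ℕ) + 1)))
      + ∑ i : Fin p.toNat, ε k (p + r + (i : ℕ)) •
          f (fun j => if (j : ℕ) < (i : ℕ) then a (j : ℕ)
              else if (j : ℕ) = (i : ℕ) then a (i : ℕ) * a ((i : ℕ) + 1)
              else a ((j : ℕ) + 1))
      + ε k r • (f (fun i => a (i : ℕ)) * a p.toNat)

/-- The family `pd` is the internal differential `∂` induced by `d_A`. -/
def IsIntDiff (R : DGAlgebra k A)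
    (pd : ∀ p r : ℤ, Coch k A p →ₗ[k] Coch k A p) : Prop :=
  ∀ (p : ℤ), 0 ≤ p → ∀ (r : ℤ) (f : Coch k A p) (dg : ℕ → ℤ) (a : ℕ → A),
    (∀ i, a i ∈ R.gr (dg i)) →
    pd p r f (fun i => a (i : ℕ)) =
      R.d (f (fun i => a (i : ℕ)))
      - ε k r • ∑ i : Fin p.toNat,
          ε k (∑ j ∈ Finset.range (i : ℕ), dg j) •
            f (fun j => if (j : ℕ) = (i : ℕ) then R.d (a (i : ℕ)) else a (j : ℕ))

/-- The family `cup` is the cup product of Hochschild cochains. -/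
def IsCup (R : DGAlgebra k A)
    (cup : ∀ p₁ r₁ p₂ r₂ : ℤ, Coch k A p₁ →ₗ[k] Coch k A p₂ →ₗ[k] Coch k A (p₁ + p₂)) : Prop :=
  ∀ (p₁ : ℤ), 0 ≤ p₁ → ∀ (p₂ : ℤ), 0 ≤ p₂ → ∀ (r₁ r₂ : ℤ)
    (f : Coch k A p₁) (g : Coch k A p₂) (dg : ℕ → ℤ) (a : ℕ → A),
    (∀ i, a i ∈ R.gr (dg i)) →
    cup p₁ r₁ p₂ r₂ f g (fun i => a (i : ℕ)) =
      ε k (p₁ * p₂ + r₂ * ((∑ j ∈ Finset.range p₁.toNat, dg j) + p₁)) •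
        (f (fun i => a (i : ℕ)) * g (fun j => a (p₁.toNat + (j : ℕ))))

/-- The family `br` is the Gerstenhaber bracket of Hochschild cochains. -/
def IsBracket
    (br : ∀ p₁ r₁ p₂ r₂ : ℤ, Coch k A p₁ →ₗ[k] Coch k A p₂ →ₗ[k] Coch k A (p₁ + p₂ - 1)) : Prop :=
  ∀ (p₁ r₁ p₂ r₂ : ℤ) (f : Coch k A p₁) (g : Coch k A p₂)
    (a : Fin (p₁ + p₂ - 1).toNat → A),
    br p₁ r₁ p₂ r₂ f g a =
      (∑ i : Fin p₁.toNat,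
        ε k ((p₁ - 1) * r₂ + (i : ℕ) * (p₂ - 1)) • compAtF p₁ p₂ ⇑f ⇑g (i : ℕ) a)
      - ε k ((p₁ + r₁ - 1) * (p₂ + r₂ - 1)) •
        ∑ j : Fin p₂.toNat,
          ε k ((p₂ - 1) * r₁ + (j : ℕ) * (p₁ - 1)) •
            compAtF p₂ p₁ ⇑g ⇑f (j : ℕ) (fun m => a (Fin.cast (by omega) m))

/- Total (sum) Hochschild complex -/

abbrev TotCoch (A : Type) [Ring A] [Algebra k A] : Type := ∀ p : ℕ, Coch k A (p : ℤ)

def TotHomog (R : DGAlgebra k A) (n : ℤ) (c : TotCoch k A) : Prop :=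
  ∀ p : ℕ, IsHomog k R p (n - p) (c p)

def TotFinSupp (c : TotCoch k A) : Prop := ∃ N : ℕ, ∀ p ≥ N, c p = 0

/-- The total differential `d_H + ∂` on the sum Hochschild complex,
applied to a total cochain of total degree `n`. -/
def TotD (dH : ∀ p r : ℤ, Coch k A p →ₗ[k] Coch k A (p + 1))
    (pd : ∀ p r : ℤ, Coch k A p →ₗ[k] Coch k A p)
    (n : ℤ) (c : TotCoch k A) : TotCoch k A :=
  fun p => match p with
  | 0 => pd 0 n (c 0)
  | (q+1) => pd ((q : ℤ) + 1) (n - ((q : ℤ) + 1)) (c (q + 1)) + dH (q : ℤ) (n - q) (c q)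

def TotIsCocycle (dH : ∀ p r : ℤ, Coch k A p →ₗ[k] Coch k A (p + 1))
    (pd : ∀ p r : ℤ, Coch k A p →ₗ[k] Coch k A p)
    (n : ℤ) (c : TotCoch k A) : Prop :=
  ∀ p : ℕ, TotD k dH pd n c p = 0

def TotIsCoboundary (R : DGAlgebra k A)
    (dH : ∀ p r : ℤ, Coch k A p →ₗ[k] Coch k A (p + 1))
    (pd : ∀ p r : ℤ, Coch k A p →ₗ[k] Coch k A p)
    (n : ℤ) (c : TotCoch k A) : Prop :=
  ∃ b : TotCoch k A, TotHomog k R (n - 1) b ∧ TotFinSupp k b ∧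
    ∀ p : ℕ, c p = TotD k dH pd (n - 1) b p

/-- Total cup product of total cochains of total degrees `n₁`, `n₂`. -/
def totCup (cup : ∀ p₁ r₁ p₂ r₂ : ℤ, Coch k A p₁ →ₗ[k] Coch k A p₂ →ₗ[k] Coch k A (p₁ + p₂))
    (n₁ n₂ : ℤ) (c c' : TotCoch k A) : TotCoch k A :=
  fun p => ∑ x ∈ (Finset.range (p + 1)).attach,
    cochCast k (by have := Finset.mem_range.mp x.2; omega)
      (cup (x.1 : ℤ) (n₁ - x.1) ((p - x.1 : ℕ) : ℤ) (n₂ - ((p - x.1 : ℕ) : ℤ))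
        (c x.1) (c' (p - x.1)))

/-- Total Gerstenhaber bracket of total cochains of total degrees `n₁`, `n₂`. -/
def totBr (br : ∀ p₁ r₁ p₂ r₂ : ℤ, Coch k A p₁ →ₗ[k] Coch k A p₂ →ₗ[k] Coch k A (p₁ + p₂ - 1))
    (n₁ n₂ : ℤ) (c c' : TotCoch k A) : TotCoch k A :=
  fun p => ∑ x ∈ (Finset.range (p + 2)).attach,
    cochCast k (by have := Finset.mem_range.mp x.2; omega)
      (br (x.1 : ℤ) (n₁ - x.1) ((p + 1 - x.1 : ℕ) : ℤ) (n₂ - ((p + 1 - x.1 : ℕ) : ℤ))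
        (c x.1) (c' (p + 1 - x.1)))

/- ## Differential graded bimodules and Hochschild cochains with coefficients -/

variable {M : Type} [AddCommGroup M] [Module k M]

/-- A dg `A`-`A`-bimodule structure on `M` over a dg algebra `(A, R)`. -/
structure DGBimod (R : DGAlgebra k A) (M : Type) [AddCommGroup M] [Module k M] : Type where
  gr : ℤ → Submodule k M
  isInternal : DirectSum.IsInternal gr
  actL : A →ₗ[k] M →ₗ[k] M
  actR : A →ₗ[k] M →ₗ[k] M
  actL_one : ∀ m, actL 1 m = m
  actL_mul : ∀ a b m, actL (a * b) m = actL a (actL b m)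
  actR_one : ∀ m, actR 1 m = m
  actR_mul : ∀ a b m, actR (a * b) m = actR b (actR a m)
  actLR : ∀ a b m, actR b (actL a m) = actL a (actR b m)
  actL_mem : ∀ {i j : ℤ} {a : A} {m : M}, a ∈ R.gr i → m ∈ gr j → actL a m ∈ gr (i + j)
  actR_mem : ∀ {i j : ℤ} {a : A} {m : M}, a ∈ R.gr i → m ∈ gr j → actR a m ∈ gr (j + i)
  dM : M →ₗ[k] M
  dM_sq : ∀ m, dM (dM m) = 0
  dM_mem : ∀ {j : ℤ} {m : M}, m ∈ gr j → dM m ∈ gr (j + 1)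
  dM_actL : ∀ {i : ℤ} (a : A) (m : M), a ∈ R.gr i →
    dM (actL a m) = actL (R.d a) m + ε k i • actL a (dM m)
  dM_actR : ∀ {j : ℤ} (a : A) (m : M), m ∈ gr j →
    dM (actR a m) = actR a (dM m) + ε k j • actR (R.d a) m

/-- A dg algebra is a dg bimodule over itself. -/
def DGAlgebra.toBimod (R : DGAlgebra k A) : DGBimod k R A where
  gr := R.gr
  isInternal := R.isInternal
  actL := LinearMap.mul k A
  actR := (LinearMap.mul k A).flip
  actL_one := fun m => one_mul m
  actL_mul := fun a b m => mul_assoc a b m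
  actR_one := fun m => mul_one m
  actR_mul := fun a b m => (mul_assoc m a b).symm
  actLR := fun a b m => mul_assoc a m b
  actL_mem := fun ha hm => R.mul_mem ha hm
  actR_mem := fun ha hm => R.mul_mem hm ha
  dM := R.d
  dM_sq := R.d_sq
  dM_mem := R.d_mem
  dM_actL := fun a m ha => R.d_leibniz a m ha
  dM_actR := fun a m hm => R.d_leibniz m a hm

/-- Hochschild `p`-cochains of `A` with values in `M`. -/
abbrev MCoch (A M : Type) [Ring A] [Algebra k A] [AddCommGroup M] [Module k M]
    (p : ℕ) : Type :=
  MultilinearMap k (fun _ : Fin p => A) M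

variable {R : DGAlgebra k A}

/-- `f` is an `M`-valued Hochschild cochain of bidegree `(p, r)`. -/
def IsHomogM (St : DGBimod k R M) (p : ℕ) (r : ℤ) (f : MCoch k A M p) : Prop :=
  ∀ (dg : ℕ → ℤ) (a : ℕ → A), (∀ i, a i ∈ R.gr (dg i)) →
    f (fun i => a (i : ℕ)) ∈ St.gr ((∑ i : Fin p, dg (i : ℕ)) + r)

/-- The family `dHM` is the Hochschild differential with values in the
dg bimodule `M`. -/
def IsHochDiffM (St : DGBimod k R M)
    (dHM : ∀ (p : ℕ) (r : ℤ), MCoch k A M p →ₗ[k] MCoch k A M (p + 1)) : Prop :=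
  ∀ (p : ℕ) (r : ℤ) (f : MCoch k A M p) (dg : ℕ → ℤ) (a : ℕ → A),
    (∀ i, a i ∈ R.gr (dg i)) →
    dHM p r f (fun i => a (i : ℕ)) =
      ε k ((p : ℤ) + r - 1 + r * dg 0) • St.actL (a 0) (f (fun i => a ((i : ℕ) + 1)))
      + ∑ i : Fin p, ε k ((p : ℤ) + r + (i : ℕ)) •
          f (fun j => if (j : ℕ) < (i : ℕ) then a (j : ℕ)
              else if (j : ℕ) = (i : ℕ) then a (i : ℕ) * a ((i : ℕ) + 1)
              else a ((j : ℕ) + 1))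
      + ε k r • St.actR (a p) (f (fun i => a (i : ℕ)))

/-- The family `pdM` is the internal differential `∂` induced by `d_A` and `d_M`. -/
def IsIntDiffM (St : DGBimod k R M)
    (pdM : ∀ (p : ℕ) (r : ℤ), MCoch k A M p →ₗ[k] MCoch k A M p) : Prop :=
  ∀ (p : ℕ) (r : ℤ) (f : MCoch k A M p) (dg : ℕ → ℤ) (a : ℕ → A),
    (∀ i, a i ∈ R.gr (dg i)) →
    pdM p r f (fun i => a (i : ℕ)) =
      St.dM (f (fun i => a (i : ℕ)))
      - ε k r • ∑ i : Fin p,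
          ε k (∑ j ∈ Finset.range (i : ℕ), dg j) •
            f (fun j => if (j : ℕ) = (i : ℕ) then R.d (a (i : ℕ)) else a (j : ℕ))

/-- Recasting an `M`-valued cochain along an equality of arities. -/
def mcochCast {p q : ℕ} (h : p = q) (f : MCoch k A M p) : MCoch k A M q :=
  f.domDomCongr (finCongr h)

/-- Post-composition `H = h∘(−)` on `M`-valued cochains. -/
def Hop (h : M →ₗ[k] M) {p : ℕ} (f : MCoch k A M p) : MCoch k A M p :=
  h.compMultilinearMap f

/-- The operators `𝔥_j = (H ∘ d_H)^j ∘ H` applied to cochains of bidegree `(p,r)`. -/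
def frakh (dHM : ∀ (p : ℕ) (r : ℤ), MCoch k A M p →ₗ[k] MCoch k A M (p + 1))
    (h : M →ₗ[k] M) (p : ℕ) (r : ℤ) : (j : ℕ) → MCoch k A M p → MCoch k A M (p + j)
  | 0, f => Hop k h f
  | (j + 1), f => Hop k h (dHM (p + j) (r - j - 1) (frakh dHM h p r j f))

/-- `h` is a contracting homotopy for the dg bimodule `M` (a degree `-1` map
with `d_M ∘ h + h ∘ d_M = id`). -/
def IsContracting (St : DGBimod k R M) (h : M →ₗ[k] M) : Prop :=
  (∀ m, St.dM (h m) + h (St.dM m) = m) ∧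
  ∀ {j : ℤ} {m : M}, m ∈ St.gr j → h m ∈ St.gr (j - 1)

/-- The acyclic dg bimodule `M` is pointwisely nilpotent: some contracting
homotopy `h` satisfies that for every Hochschild cochain `f` with values in `M`
there is `N` with `𝔥_j f = 0` for all `j > N`. -/
def PointwiseNilpotent (St : DGBimod k R M)
    (dHM : ∀ (p : ℕ) (r : ℤ), MCoch k A M p →ₗ[k] MCoch k A M (p + 1)) : Prop :=
  ∃ h : M →ₗ[k] M, IsContracting k St h ∧
    ∀ (p : ℕ) (r : ℤ) (f : MCoch k A M p), IsHomogM k St p r f →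
      ∃ N : ℕ, ∀ j : ℕ, j > N → frakh k dHM h p r j f = 0

/- Total complex with values in `M` -/

abbrev TotMCoch (A M : Type) [Ring A] [Algebra k A] [AddCommGroup M] [Module k M] : Type :=
  ∀ p : ℕ, MCoch k A M p

def TotHomogM (St : DGBimod k R M) (n : ℤ) (c : TotMCoch k A M) : Prop :=
  ∀ p : ℕ, IsHomogM k St p (n - p) (c p)

def TotFinSuppM (c : TotMCoch k A M) : Prop := ∃ N : ℕ, ∀ p ≥ N, c p = 0

def TotDM (dHM : ∀ (p : ℕ) (r : ℤ), MCoch k A M p →ₗ[k] MCoch k A M (p + 1))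
    (pdM : ∀ (p : ℕ) (r : ℤ), MCoch k A M p →ₗ[k] MCoch k A M p)
    (n : ℤ) (c : TotMCoch k A M) : TotMCoch k A M :=
  fun p => match p with
  | 0 => pdM 0 n (c 0)
  | (q + 1) => pdM (q + 1) (n - ((q : ℤ) + 1)) (c (q + 1)) + dHM q (n - q) (c q)

def TotIsCocycleM (dHM : ∀ (p : ℕ) (r : ℤ), MCoch k A M p →ₗ[k] MCoch k A M (p + 1))
    (pdM : ∀ (p : ℕ) (r : ℤ), MCoch k A M p →ₗ[k] MCoch k A M p)
    (n : ℤ) (c : TotMCoch k A M) : Prop :=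
  ∀ p : ℕ, TotDM k dHM pdM n c p = 0

def TotIsCoboundaryM (St : DGBimod k R M)
    (dHM : ∀ (p : ℕ) (r : ℤ), MCoch k A M p →ₗ[k] MCoch k A M (p + 1))
    (pdM : ∀ (p : ℕ) (r : ℤ), MCoch k A M p →ₗ[k] MCoch k A M p)
    (n : ℤ) (c : TotMCoch k A M) : Prop :=
  ∃ b : TotMCoch k A M, TotHomogM k St (n - 1) b ∧ TotFinSuppM k b ∧
    ∀ p : ℕ, c p = TotDM k dHM pdM (n - 1) b p

/- Morphisms of dg bimodules, quasi-isomorphisms, mapping cones -/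

variable {N : Type} [AddCommGroup N] [Module k N]

/-- Morphism of dg `A`-`A`-bimodules (degree-preserving, chain map, bilinear). -/
def IsBimodHom (StM : DGBimod k R M) (StN : DGBimod k R N) (φ : M →ₗ[k] N) : Prop :=
  (∀ (i : ℤ) (m : M), m ∈ StM.gr i → φ m ∈ StN.gr i)
  ∧ (∀ m, φ (StM.dM m) = StN.dM (φ m))
  ∧ (∀ a m, φ (StM.actL a m) = StN.actL a (φ m))
  ∧ (∀ a m, φ (StM.actR a m) = StN.actR a (φ m))

/-- `φ` is a quasi-isomorphism of dg bimodules (bijective on cohomology). -/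
def IsQuasiIso (StM : DGBimod k R M) (StN : DGBimod k R N) (φ : M →ₗ[k] N) : Prop :=
  (∀ (i : ℤ) (n : N), n ∈ StN.gr i → StN.dM n = 0 →
    ∃ m ∈ StM.gr i, StM.dM m = 0 ∧ ∃ n' ∈ StN.gr (i - 1), φ m - n = StN.dM n')
  ∧ (∀ (i : ℤ) (m : M), m ∈ StM.gr i → StM.dM m = 0 →
    (∃ n' ∈ StN.gr (i - 1), φ m = StN.dM n') →
    ∃ m' ∈ StM.gr (i - 1), m = StM.dM m')

/-- `(C, SC, inM, inN)` is a model for the mapping cone `Cone(φ) = M[1] ⊕ N`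
as a dg `A`-`A`-bimodule. -/
def IsConeModel (StM : DGBimod k R M) (StN : DGBimod k R N) (φ : M →ₗ[k] N)
    {C : Type} [AddCommGroup C] [Module k C] (SC : DGBimod k R C)
    (inM : M →ₗ[k] C) (inN : N →ₗ[k] C) : Prop :=
  Function.Bijective (fun mn : M × N => inM mn.1 + inN mn.2)
  ∧ (∀ m, SC.dM (inM m) = - inM (StM.dM m) + inN (φ m))
  ∧ (∀ n, SC.dM (inN n) = inN (StN.dM n))
  ∧ (∀ (i : ℤ) (m : M), m ∈ StM.gr (i + 1) → inM m ∈ SC.gr i)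
  ∧ (∀ (i : ℤ) (n : N), n ∈ StN.gr i → inN n ∈ SC.gr i)
  ∧ (∀ (i : ℤ) (c : C), c ∈ SC.gr i → ∃ m ∈ StM.gr (i + 1), ∃ n ∈ StN.gr i,
      c = inM m + inN n)
  ∧ (∀ (i : ℤ) (a : A) (m : M), a ∈ R.gr i →
      SC.actL a (inM m) = ε k i • inM (StM.actL a m))
  ∧ (∀ (a : A) (n : N), SC.actL a (inN n) = inN (StN.actL a n))
  ∧ (∀ (a : A) (m : M), SC.actR a (inM m) = inM (StM.actR a m))
  ∧ (∀ (a : A) (n : N), SC.actR a (inN n) = inN (StN.actR a n))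

/-- A bundled model of the mapping cone of `φ`. -/
structure ConeData (StM : DGBimod k R M) (StN : DGBimod k R N) (φ : M →ₗ[k] N) where
  C : Type
  [instAdd : AddCommGroup C]
  [instMod : Module k C]
  SC : DGBimod k R C
  inM : M →ₗ[k] C
  inN : N →ₗ[k] C
  isCone : IsConeModel k StM StN φ SC inM inN

attribute [instance] ConeData.instAdd ConeData.instMod

/-- The mapping cone of `φ` is pointwisely nilpotent. -/
def ConePN (StM : DGBimod k R M) (StN : DGBimod k R N) (φ : M →ₗ[k] N) : Prop :=
  ∃ D : ConeData k StM StN φ,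
    ∃ dHC : ∀ (p : ℕ) (r : ℤ), MCoch k A D.C p →ₗ[k] MCoch k A D.C (p + 1),
      IsHochDiffM k D.SC dHC ∧ PointwiseNilpotent k D.SC dHC

/-- `φ` is weakly cone-nilpotent: its mapping cone is pointwisely nilpotent, or
it admits a right (resp. left) inverse morphism of dg bimodules whose mapping
cone is pointwisely nilpotent. -/
def WeaklyConeNilpotent (StM : DGBimod k R M) (StN : DGBimod k R N) (φ : M →ₗ[k] N) : Prop :=
  ConePN k StM StN φ
  ∨ (∃ ψ : N →ₗ[k] M, IsBimodHom k StN StM ψ ∧ (∀ n, φ (ψ n) = n) ∧ ConePN k StN StM ψ)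
  ∨ (∃ ψ : N →ₗ[k] M, IsBimodHom k StN StM ψ ∧ (∀ m, ψ (φ m) = m) ∧ ConePN k StN StM ψ)

theorem ε_add (m n : ℤ) : ε k (m + n) = ε k m * ε k n := by
  unfold ε
  by_cases hm : Even m <;> by_cases hn : Even n <;> simp [Int.even_add, hm, hn]

theorem ε_mul_self (m : ℤ) : ε k m * ε k m = 1 := by
  unfold ε
  split_ifs <;> simp

theorem ε_one : ε k 1 = -1 := by simp [ε]

theorem ε_zero : ε k 0 = 1 := by simp [ε]

theorem ε_natCast (n : ℕ) : ε k (n : ℤ) = (-1) ^ n := by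
  induction n with
  | zero => simp [ε_zero]
  | succ n ih => rw [Nat.cast_succ, ε_add, ih, ε_one, pow_succ]

theorem ε_neg (m : ℤ) : ε k (-m) = ε k m := by simp [ε]

/-- The sequence obtained from `a` by multiplying its entries at `i` and `i + 1`. -/
def face (i : ℕ) (a : ℕ → A) : ℕ → A :=
  fun j => if j < i then a j else if j = i then a i * a (i + 1) else a (j + 1)

/-- The degrees of the entries of `face i a`. -/
def faceDeg (i : ℕ) (dg : ℕ → ℤ) : ℕ → ℤ :=
  fun j => if j < i then dg j else if j = i then dg i + dg (i + 1) else dg (j + 1)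

/-- The sequence obtained from `a` by applying the differential to its entry at `i`. -/
def diffAt (R : DGAlgebra k A) (i : ℕ) (a : ℕ → A) : ℕ → A :=
  fun j => if j = i then R.d (a i) else a j

/-- The degrees of the entries of `diffAt R i a`. -/
def diffAtDeg (i : ℕ) (dg : ℕ → ℤ) : ℕ → ℤ :=
  fun j => if j = i then dg i + 1 else dg j

variable {k}

theorem face_mem {dg : ℕ → ℤ} {a : ℕ → A} (ha : ∀ i, a i ∈ R.gr (dg i)) (i j : ℕ) :
    face i a j ∈ R.gr (faceDeg i dg j) := by
  unfold face faceDeg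
  split_ifs
  exacts [ha _, R.mul_mem (ha _) (ha _), ha _]

theorem diffAt_mem {dg : ℕ → ℤ} {a : ℕ → A} (ha : ∀ i, a i ∈ R.gr (dg i)) (i j : ℕ) :
    diffAt k R i a j ∈ R.gr (diffAtDeg i dg j) := by
  unfold diffAt diffAtDeg
  split_ifs
  exacts [R.d_mem (ha _), ha _]

theorem face_face {i j : ℕ} (h : j ≤ i) (a : ℕ → A) :
    face j (face (i + 1) a) = face i (face j a) := by
  funext l
  unfold face
  rcases lt_trichotomy l j with hl | rfl | hl
  · grind
  · rcases h.eq_or_lt with rfl | h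
    · simp [mul_assoc]
    · grind
  · grind

theorem sum_range_merge {X : Type*} [AddCommMonoid X] {p j : ℕ} (hj : j < p) {u v : ℕ → X}
    (hlt : ∀ i < j, v i = u i) (heq : v j = u j + u (j + 1)) (hgt : ∀ i > j, v i = u (i + 1)) :
    ∑ i ∈ Finset.range p, v i = ∑ i ∈ Finset.range (p + 1), u i := by
  induction p, hj using Nat.le_induction with
  | base =>
    rw [Finset.sum_range_succ, heq, Finset.sum_range_succ, Finset.sum_range_succ, add_assoc]
    congr 1
    exact Finset.sum_congr rfl fun i hi => hlt i (Finset.mem_range.1 hi)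
  | succ p hp ih => rw [Finset.sum_range_succ, ih, hgt p hp, ← Finset.sum_range_succ]

theorem sum_faceDeg_of_le {i j : ℕ} (h : i ≤ j) (dg : ℕ → ℤ) :
    ∑ l ∈ Finset.range i, faceDeg j dg l = ∑ l ∈ Finset.range i, dg l :=
  Finset.sum_congr rfl fun l hl => by
    simp [faceDeg, (Finset.mem_range.1 hl).trans_le h]

theorem sum_faceDeg_of_lt {i j : ℕ} (h : j < i) (dg : ℕ → ℤ) :
    ∑ l ∈ Finset.range i, faceDeg j dg l = ∑ l ∈ Finset.range (i + 1), dg l :=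
  sum_range_merge h (fun l hl => by simp [faceDeg, hl]) (by simp [faceDeg])
    (fun l hl => by simp [faceDeg, hl.ne', hl.le])

/-- Two cochains which agree on homogeneous arguments are equal. -/
theorem mcoch_ext {p : ℕ} {f g : MCoch k A M p}
    (h : ∀ (dg : ℕ → ℤ) (a : ℕ → A), (∀ i, a i ∈ R.gr (dg i)) →
      f (fun i => a (i : ℕ)) = g (fun i => a (i : ℕ))) : f = g := by
  classical
  let v := fun i => Module.Free.chooseBasis k (R.gr i)
  refine Module.Basis.ext_multilinear (fun _ => R.isInternal.collectedBasis v) fun w => ?_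
  have := h (fun j => if hj : j < p then (w ⟨j, hj⟩).1 else 0)
    (fun j => if hj : j < p then R.isInternal.collectedBasis v (w ⟨j, hj⟩) else 0) fun j => by
      by_cases hj : j < p
      · simp only [hj, dite_true]
        exact R.isInternal.collectedBasis_mem v _
      · simp [hj]
  simpa using this

variable {St : DGBimod k R M}
  {dHM : ∀ (p : ℕ) (r : ℤ), MCoch k A M p →ₗ[k] MCoch k A M (p + 1)}
  {pdM : ∀ (p : ℕ) (r : ℤ), MCoch k A M p →ₗ[k] MCoch k A M p}

theorem IsHochDiffM.apply (hd : IsHochDiffM k St dHM) (p : ℕ) (r : ℤ) (f : MCoch k A M p)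
    {dg : ℕ → ℤ} {a : ℕ → A} (ha : ∀ i, a i ∈ R.gr (dg i)) :
    dHM p r f (fun i => a (i : ℕ)) = ((-1) ^ p * ε k r) •
      (-(ε k (r * dg 0) • St.actL (a 0) (f fun i => a ((i : ℕ) + 1)))
        + ∑ i ∈ Finset.range p, (-1 : k) ^ i • f (fun j => face i a j)
        + (-1 : k) ^ p • St.actR (a p) (f fun i => a (i : ℕ))) := by
  rw [hd p r f dg a ha, Finset.sum_range, smul_add, smul_add, Finset.smul_sum]
  have h1 : ε k ((p : ℤ) + r - 1 + r * dg 0) = - ((-1) ^ p * ε k r * ε k (r * dg 0)) := by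
    rw [sub_eq_add_neg, ε_add, ε_add, ε_add, ε_neg, ε_natCast, ε_one]; ring
  have h2 : ((-1) ^ p * ε k r) * (-1 : k) ^ p = ε k r := by
    rw [mul_right_comm, ← mul_pow]; simp
  congr 1
  · congr 1
    · rw [h1, smul_neg, smul_smul, neg_smul]
    · refine Finset.sum_congr rfl fun i _ => ?_
      rw [smul_smul, ε_add, ε_add, ε_natCast, ε_natCast]
      rfl
  · rw [smul_smul, h2]

theorem IsIntDiffM.apply (hp : IsIntDiffM k St pdM) (p : ℕ) (r : ℤ) (f : MCoch k A M p)
    {dg : ℕ → ℤ} {a : ℕ → A} (ha : ∀ i, a i ∈ R.gr (dg i)) :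
    pdM p r f (fun i => a (i : ℕ)) = St.dM (f fun i => a (i : ℕ)) - ε k r •
      ∑ i ∈ Finset.range p, ε k (∑ j ∈ Finset.range i, dg j) •
        f (fun j => diffAt k R i a j) := by
  rw [hp p r f dg a ha, Finset.sum_range]
  rfl

theorem IsHochDiffM.isHomogM (hd : IsHochDiffM k St dHM) {p : ℕ} {r : ℤ} {f : MCoch k A M p}
    (hf : IsHomogM k St p r f) : IsHomogM k St (p + 1) r (dHM p r f) := by
  intro dg a ha
  rw [hd.apply p r f ha]
  rw [Fin.sum_univ_eq_sum_range (fun i => dg i)]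
  refine Submodule.smul_mem _ _ (Submodule.add_mem _ (Submodule.add_mem _ (Submodule.neg_mem _
    (Submodule.smul_mem _ _ ?_)) (Submodule.sum_mem _ fun i hi => Submodule.smul_mem _ _ ?_))
    (Submodule.smul_mem _ _ ?_))
  · have := St.actL_mem (ha 0) (hf (fun i => dg (i + 1)) (fun i => a (i + 1)) fun i => ha _)
    rw [Fin.sum_univ_eq_sum_range (fun i => dg (i + 1))] at this
    rw [Finset.sum_range_succ']
    convert this using 2
    ring
  · have := hf _ _ (face_mem ha i)
    rw [Fin.sum_univ_eq_sum_range (fun j => faceDeg i dg j)] at this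
    convert this using 3
    exact (sum_faceDeg_of_lt (Finset.mem_range.1 hi) dg).symm
  · have := St.actR_mem (ha p) (hf dg a ha)
    rw [Fin.sum_univ_eq_sum_range (fun i => dg i)] at this
    rw [Finset.sum_range_succ]
    convert this using 2
    ring

theorem isHomogM_Hop {h : M →ₗ[k] M} (hh : IsContracting k St h) {p : ℕ} {r : ℤ}
    {f : MCoch k A M p} (hf : IsHomogM k St p r f) : IsHomogM k St p (r - 1) (Hop k h f) := by
  intro dg a ha
  rw [← add_sub_assoc]
  exact hh.2 (hf dg a ha)

theorem pdM_Hop (hp : IsIntDiffM k St pdM) {h : M →ₗ[k] M} (hh : IsContracting k St h)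
    (p : ℕ) (r : ℤ) (f : MCoch k A M p) :
    pdM p (r - 1) (Hop k h f) + Hop k h (pdM p r f) = f := by
  refine mcoch_ext (R := R) fun dg a ha => ?_
  rw [add_apply, hp.apply p _ _ ha]
  change _ + h (pdM p r f _) = _
  rw [hp.apply p _ _ ha]
  have : ε k (r - 1) = - ε k r := by
    rw [sub_eq_add_neg, ε_add, ε_neg, ε_one]; ring
  simp only [this, Hop, LinearMap.compMultilinearMap_apply, map_sub, map_smul, map_sum, neg_smul]
  conv_rhs => rw [← hh.1 (f fun i => a i)]
  abel

theorem sum_alternating_presimplicial {p : ℕ} (g : ℕ → ℕ → M)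
    (hg : ∀ i j, j ≤ i → g (i + 1) j = g j i) :
    ∑ i ∈ Finset.range (p + 1), ∑ j ∈ Finset.range p, (-1 : k) ^ (i + j) • g i j = 0 := by
  induction p with
  | zero => simp
  | succ p ih =>
    have h (i : ℕ) : ∑ j ∈ Finset.range (p + 1), (-1 : k) ^ (i + j) • g i j =
        ∑ j ∈ Finset.range p, (-1 : k) ^ (i + j) • g i j + (-1 : k) ^ (i + p) • g i p :=
      Finset.sum_range_succ _ p
    rw [Finset.sum_range_succ, Finset.sum_congr rfl fun i _ => h i, Finset.sum_add_distrib, ih,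
      zero_add, ← Finset.sum_add_distrib]
    refine Finset.sum_eq_zero fun i hi => ?_
    rw [hg p i (Finset.mem_range_succ_iff.1 hi)]
    module

theorem sum_smul_smul_neg_add_add (t : Finset ℕ) (w : ℕ → k) (c e : k) (x y z : ℕ → M) :
    ∑ i ∈ t, w i • c • (-x i + y i + e • z i) =
      c • (-∑ i ∈ t, w i • x i + ∑ i ∈ t, w i • y i + e • ∑ i ∈ t, w i • z i) := by
  rw [← Finset.sum_neg_distrib, Finset.smul_sum, ← Finset.sum_add_distrib,
    ← Finset.sum_add_distrib, Finset.smul_sum]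
  exact Finset.sum_congr rfl fun i _ => by module

theorem dHM_dHM (hd : IsHochDiffM k St dHM) (p : ℕ) (r : ℤ) (f : MCoch k A M p) :
    dHM (p + 1) r (dHM p r f) = 0 := by
  refine mcoch_ext (R := R) fun dg a ha => ?_
  rw [hd.apply _ _ _ ha, hd.apply p r f (fun i => ha (i + 1)), hd.apply p r f ha]
  have hL : ∑ i ∈ Finset.range (p + 1), (-1 : k) ^ i • ε k (r * faceDeg i dg 0) •
      St.actL (face i a 0) (f fun l => face i a (l + 1)) =
      (ε k (r * dg 0) * ε k (r * dg 1)) • St.actL (a 0) (St.actL (a 1) (f fun l => a (l + 1 + 1)))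
      - ε k (r * dg 0) • ∑ i ∈ Finset.range p, (-1 : k) ^ i •
          St.actL (a 0) (f fun l => face i (fun m => a (m + 1)) l) := by
    rw [Finset.sum_range_succ', add_comm, sub_eq_add_neg, Finset.smul_sum, ← Finset.sum_neg_distrib]
    congr 1
    · simp [face, faceDeg, St.actL_mul, mul_add, ε_add]
    · refine Finset.sum_congr rfl fun i _ => ?_
      have : (fun l : Fin p => face (i + 1) a (l + 1)) =
          fun l : Fin p => face i (fun m => a (m + 1)) l := by
        funext l
        simp [face]
      rw [this]
      simp only [face, faceDeg, Nat.zero_lt_succ, if_true]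
      module
  have hM := sum_alternating_presimplicial (k := k) (p := p)
    (fun i j => f fun l => face j (face i a) l) fun i j h => by simp only [face_face h]
  have hR : ∑ i ∈ Finset.range (p + 1), (-1 : k) ^ i •
      St.actR (face i a p) (f fun l => face i a l) =
      ∑ i ∈ Finset.range p, (-1 : k) ^ i • St.actR (a (p + 1)) (f fun l => face i a l)
      + (-1 : k) ^ p • St.actR (a (p + 1)) (St.actR (a p) (f fun l => a l)) := by
    rw [Finset.sum_range_succ]
    congr 1
    · refine Finset.sum_congr rfl fun i hi => ?_
      have hi := Finset.mem_range.1 hi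
      rw [show face i a p = a (p + 1) by simp [face, hi.ne', hi.le]]
    · have : (fun l : Fin p => face p a l) = fun l : Fin p => a l := by
        funext l
        simp [face]
      rw [this, ← St.actR_mul]
      simp [face]
  simp only [pow_add, mul_smul] at hM
  simp only [← Finset.smul_sum] at hM
  have hmid : ∑ i ∈ Finset.range (p + 1), (-1 : k) ^ i • dHM p r f (fun l => face i a l) = _ :=
    (Finset.sum_congr rfl fun i _ => by rw [hd.apply p r f (face_mem ha i)]).trans
      (sum_smul_smul_neg_add_add _ _ _ _ _ _ _)
  rw [hmid, hL, hM, hR, zero_apply]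
  simp only [map_smul, map_add, map_neg, map_sum, St.actLR]
  module

theorem sum_apply_face_diffAt {p : ℕ} (f : MCoch k A M p) {dg : ℕ → ℤ} {a : ℕ → A}
    (ha : ∀ i, a i ∈ R.gr (dg i)) {j : ℕ} (hj : j < p) :
    ∑ i ∈ Finset.range p, ε k (∑ l ∈ Finset.range i, faceDeg j dg l) •
        f (fun l => diffAt k R i (face j a) l) =
      ∑ i ∈ Finset.range (p + 1), ε k (∑ l ∈ Finset.range i, dg l) •
        f (fun l => face j (diffAt k R i a) l) := by
  have key {i i' : ℕ} (h : ∀ l, diffAt k R i (face j a) l = face j (diffAt k R i' a) l) :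
      f (fun l => diffAt k R i (face j a) l) = f (fun l => face j (diffAt k R i' a) l) :=
    congrArg f (funext fun l => h l)
  refine sum_range_merge hj (fun i hi => ?_) ?_ (fun i hi => ?_)
  · rw [sum_faceDeg_of_le hi.le, key]
    intro l
    simp only [diffAt, face]
    grind
  · have hupd (x : A) : (fun l : Fin p => if (l : ℕ) = j then x else face j a l) =
        Function.update (fun l : Fin p => face j a l) ⟨j, hj⟩ x := by
      funext l
      simp [Function.update_apply, Fin.ext_iff]
    have h1 : (fun l : Fin p => diffAt k R j (face j a) l) =
        Function.update (fun l : Fin p => face j a l) ⟨j, hj⟩ (R.d (a j * a (j + 1))) := by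
      rw [← hupd]
      funext l
      simp [diffAt, face]
    have h2 : (fun l : Fin p => face j (diffAt k R j a) l) =
        Function.update (fun l : Fin p => face j a l) ⟨j, hj⟩ (R.d (a j) * a (j + 1)) := by
      rw [← hupd]
      funext l
      simp only [diffAt, face]
      grind
    have h3 : (fun l : Fin p => face j (diffAt k R (j + 1) a) l) =
        Function.update (fun l : Fin p => face j a l) ⟨j, hj⟩ (a j * R.d (a (j + 1))) := by
      rw [← hupd]
      funext l
      simp only [diffAt, face]
      grind
    rw [h1, h2, h3, R.d_leibniz _ _ (ha j), MultilinearMap.map_update_add,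
      MultilinearMap.map_update_smul, sum_faceDeg_of_le le_rfl, Finset.sum_range_succ, ε_add]
    module
  · rw [sum_faceDeg_of_lt hi, key]
    intro l
    simp only [diffAt, face]
    grind

theorem pdM_dHM (hd : IsHochDiffM k St dHM) (hp : IsIntDiffM k St pdM) {p : ℕ} {r : ℤ}
    {f : MCoch k A M p} (hf : IsHomogM k St p r f) :
    pdM (p + 1) r (dHM p r f) + dHM p (r + 1) (pdM p r f) = 0 := by
  refine mcoch_ext (R := R) fun dg a ha => ?_
  rw [add_apply, hp.apply _ _ _ ha, hd.apply p r f ha, hd.apply p (r + 1) _ ha,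
    hp.apply p r f ha, hp.apply p r f (fun i => ha (i + 1))]
  have hfa := hf dg a ha
  rw [Fin.sum_univ_eq_sum_range (fun i => dg i)] at hfa
  have hL : ∑ i ∈ Finset.range (p + 1), ε k (∑ l ∈ Finset.range i, dg l) •
      ε k (r * diffAtDeg i dg 0) •
        St.actL (diffAt k R i a 0) (f fun l => diffAt k R i a (l + 1)) =
      ε k (r * dg 0) • ε k r • St.actL (R.d (a 0)) (f fun l => a (l + 1))
      + ε k (r * dg 0) • ε k (dg 0) • ∑ i ∈ Finset.range p,
        ε k (∑ l ∈ Finset.range i, dg (l + 1)) •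
          St.actL (a 0) (f fun l => diffAt k R i (fun m => a (m + 1)) l) := by
    rw [Finset.sum_range_succ', add_comm, Finset.smul_sum, Finset.smul_sum]
    congr 1
    · simp [diffAt, diffAtDeg, mul_add, ε_add, ε_zero, mul_smul]
    · refine Finset.sum_congr rfl fun i _ => ?_
      have : (fun l : Fin p => diffAt k R (i + 1) a (l + 1)) =
          fun l : Fin p => diffAt k R i (fun m => a (m + 1)) l := by
        funext l
        simp [diffAt]
      rw [this, Finset.sum_range_succ', ε_add]
      simp only [diffAt, diffAtDeg, (Nat.succ_ne_zero i).symm, if_false]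
      module
  have hR : ∑ i ∈ Finset.range (p + 1), ε k (∑ l ∈ Finset.range i, dg l) •
        St.actR (diffAt k R i a p) (f fun l => diffAt k R i a l) =
      ∑ i ∈ Finset.range p, ε k (∑ l ∈ Finset.range i, dg l) •
        St.actR (a p) (f fun l => diffAt k R i a l)
      + ε k (∑ l ∈ Finset.range p, dg l) • St.actR (R.d (a p)) (f fun l => a l) := by
    rw [Finset.sum_range_succ]
    congr 1
    · refine Finset.sum_congr rfl fun i hi => ?_
      rw [show diffAt k R i a p = a p by simp [diffAt, (Finset.mem_range.1 hi).ne']]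
    · have : (fun l : Fin p => diffAt k R p a l) = fun l : Fin p => a l := by
        funext l
        simp [diffAt, l.2.ne]
      rw [this]
      simp [diffAt]
  have hM : ∑ i ∈ Finset.range (p + 1), ε k (∑ l ∈ Finset.range i, dg l) •
      ∑ j ∈ Finset.range p, (-1 : k) ^ j • f (fun l => face j (diffAt k R i a) l) =
      ∑ j ∈ Finset.range p, (-1 : k) ^ j • ∑ i ∈ Finset.range (p + 1),
        ε k (∑ l ∈ Finset.range i, dg l) • f (fun l => face j (diffAt k R i a) l) := by
    simp only [Finset.smul_sum]
    rw [Finset.sum_comm]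
    exact Finset.sum_congr rfl fun j _ => Finset.sum_congr rfl fun i _ => smul_comm _ _ _
  have hδ : ∑ i ∈ Finset.range (p + 1), ε k (∑ l ∈ Finset.range i, dg l) •
      dHM p r f (fun l => diffAt k R i a l) = _ :=
    (Finset.sum_congr rfl fun i _ => by rw [hd.apply p r f (diffAt_mem ha i)]).trans
      (sum_smul_smul_neg_add_add _ _ _ _ _ _ _)
  have hd' : ∑ j ∈ Finset.range p, (-1 : k) ^ j • pdM p r f (fun l => face j a l) =
      ∑ j ∈ Finset.range p, (-1 : k) ^ j • St.dM (f fun l => face j a l) - ε k r •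
        ∑ j ∈ Finset.range p, (-1 : k) ^ j • ∑ i ∈ Finset.range (p + 1),
          ε k (∑ l ∈ Finset.range i, dg l) • f (fun l => face j (diffAt k R i a) l) := by
    rw [Finset.smul_sum, ← Finset.sum_sub_distrib]
    refine Finset.sum_congr rfl fun j hj => ?_
    rw [hp.apply p r f (face_mem ha j), sum_apply_face_diffAt f ha (Finset.mem_range.1 hj)]
    module
  have hε1 : ε k (r + 1) = - ε k r := by rw [ε_add, ε_one]; ring
  have hε2 : ε k ((r + 1) * dg 0) = ε k (r * dg 0) * ε k (dg 0) := by
    rw [add_mul, one_mul, ε_add]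
  rw [hδ, hL, hM, hR, hd', hε1, hε2, zero_apply]
  simp only [map_smul, map_add, map_neg, map_sub, map_sum, St.dM_actL _ _ (ha 0),
    St.dM_actR _ _ hfa, ε_add]
  linear_combination (norm := module) ((-1) ^ p * ε k r * ε k (r * dg 0)) • ε_mul_self k r •
    St.actL (R.d (a 0)) (f fun l => a (l + 1))

variable (k)

/-- The right-hand side of the equation `∂ b_p = c_p - d_H b_{p - 1}`, which is solved recursively
by `b_p = h ∘ (c_p - d_H b_{p - 1})`. -/
def residual (dHM : ∀ (p : ℕ) (r : ℤ), MCoch k A M p →ₗ[k] MCoch k A M (p + 1))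
    (h : M →ₗ[k] M) (n : ℤ) (c : TotMCoch k A M) : TotMCoch k A M
  | 0 => c 0
  | q + 1 => c (q + 1) - dHM q (n - 1 - q) (Hop k h (residual dHM h n c q))

variable {k}

theorem isHomogM_residual (hd : IsHochDiffM k St dHM) {h : M →ₗ[k] M} (hh : IsContracting k St h)
    {n : ℤ} {c : TotMCoch k A M} (hc : TotHomogM k St n c) :
    TotHomogM k St n (residual k dHM h n c) := by
  intro p
  induction p with
  | zero => exact hc 0
  | succ q ih =>
    intro dg a ha
    have hb := hd.isHomogM (isHomogM_Hop hh ih)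
    rw [show n - q - 1 = n - (q + 1 : ℕ) by push_cast; ring] at hb
    have := Submodule.sub_mem _ (hc (q + 1) dg a ha) (hb dg a ha)
    rw [show n - (q + 1 : ℕ) = n - 1 - q by push_cast; ring] at this ⊢
    exact this

theorem dHM_residual (hd : IsHochDiffM k St dHM) (h : M →ₗ[k] M) (n : ℤ) (c : TotMCoch k A M)
    (p : ℕ) : dHM p (n - p) (residual k dHM h n c p) = dHM p (n - p) (c p) := by
  cases p with
  | zero => rfl
  | succ q =>
    rw [residual, map_sub, show n - (q + 1 : ℕ) = n - 1 - q by push_cast; ring, dHM_dHM hd,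
      sub_zero]

theorem pdM_Hop_residual (hd : IsHochDiffM k St dHM) (hp : IsIntDiffM k St pdM) {h : M →ₗ[k] M}
    (hh : IsContracting k St h) {n : ℤ} {c : TotMCoch k A M} (hc : TotHomogM k St n c)
    (hcocycle : TotIsCocycleM k dHM pdM n c) (p : ℕ) :
    pdM p (n - 1 - p) (Hop k h (residual k dHM h n c p)) = residual k dHM h n c p := by
  suffices hz : pdM p (n - p) (residual k dHM h n c p) = 0 by
    have := pdM_Hop hp hh p (n - p) (residual k dHM h n c p)
    rw [hz, sub_right_comm] at this
    simpa [Hop] using this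
  induction p with
  | zero =>
    rw [Nat.cast_zero, sub_zero]
    exact hcocycle 0
  | succ q ih =>
    have hb := pdM_Hop hp hh q (n - q) (residual k dHM h n c q)
    have hhom := isHomogM_Hop hh (isHomogM_residual hd hh hc q)
    have hanti := pdM_dHM hd hp hhom
    have hcq : pdM (q + 1) (n - ((q : ℤ) + 1)) (c (q + 1)) + dHM q (n - q) (c q) = 0 :=
      hcocycle (q + 1)
    have hH : Hop k h (0 : MCoch k A M q) = 0 := by simp [Hop]
    rw [ih, hH, add_zero] at hb
    rw [hb, sub_add_cancel, dHM_residual hd] at hanti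
    rw [residual, map_sub, Nat.cast_succ, sub_right_comm n 1, sub_eq_zero,
      eq_neg_of_add_eq_zero_left hcq, ← eq_neg_of_add_eq_zero_left hanti]
    congr 2
    ring

theorem Hop_residual_add (dHM : ∀ (p : ℕ) (r : ℤ), MCoch k A M p →ₗ[k] MCoch k A M (p + 1))
    (h : M →ₗ[k] M) (n : ℤ) {c : TotMCoch k A M} {N : ℕ} (hN : ∀ p ≥ N, c p = 0) (j : ℕ) :
    Hop k h (residual k dHM h n c (N + j)) =
      (-1 : k) ^ j • frakh k dHM h N (n - N) j (residual k dHM h n c N) := by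
  induction j with
  | zero => simp [frakh]
  | succ j ih =>
    change Hop k h (c (N + j + 1) - dHM (N + j) (n - 1 - (N + j : ℕ))
      (Hop k h (residual k dHM h n c (N + j)))) = (-1 : k) ^ (j + 1) • Hop k h
        (dHM (N + j) (n - N - j - 1) (frakh k dHM h N (n - N) j (residual k dHM h n c N)))
    rw [ih, hN _ (by omega), show n - N - j - 1 = n - 1 - (N + j : ℕ) by push_cast; ring]
    ext a
    simp [Hop, pow_succ]

/-- Let `A` be a dg algebra over a field `k` of characteristic
zero and `M` an acyclic dg `A`-`A`-bimodule.  If `M` is pointwisely nilpotent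
then `HH_⊕^•(A, M) = 0`, i.e. every total cocycle of the sum Hochschild complex
`(Hoch_⊕^•(A,M), d_H + ∂)` is a total coboundary. -/
theorem statement6
    (k : Type) [Field k] [CharZero k]
    (A : Type) [Ring A] [Algebra k A]
    (M : Type) [AddCommGroup M] [Module k M]
    (R : KD.DGAlgebra k A) (St : KD.DGBimod k R M)
    (hacyclic : ∀ m : M, St.dM m = 0 → ∃ m' : M, m = St.dM m')
    (dHM : ∀ (p : ℕ) (r : ℤ), KD.MCoch k A M p →ₗ[k] KD.MCoch k A M (p + 1))
    (pdM : ∀ (p : ℕ) (r : ℤ), KD.MCoch k A M p →ₗ[k] KD.MCoch k A M p)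
    (hdHM : KD.IsHochDiffM k St dHM) (hpdM : KD.IsIntDiffM k St pdM)
    (hPN : KD.PointwiseNilpotent k St dHM) :
    ∀ (n : ℤ) (c : KD.TotMCoch k A M),
      KD.TotHomogM k St n c → KD.TotFinSuppM k c → KD.TotIsCocycleM k dHM pdM n c →
      KD.TotIsCoboundaryM k St dHM pdM n c := by
  intro n c hc ⟨N, hN⟩ hcocycle
  obtain ⟨h, hh, hnil⟩ := hPN
  have hhom := isHomogM_residual hdHM hh hc
  refine ⟨fun p => Hop k h (residual k dHM h n c p), fun p => ?_, ?_, fun p => ?_⟩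
  · rw [sub_right_comm]
    exact isHomogM_Hop hh (hhom p)
  · obtain ⟨J, hJ⟩ := hnil N _ _ (hhom N)
    refine ⟨N + J + 1, fun p hp => ?_⟩
    obtain ⟨j, rfl⟩ : ∃ j, p = N + j := ⟨p - N, by omega⟩
    exact (Hop_residual_add dHM h n hN j).trans (by rw [hJ j (by omega), smul_zero])
  · have hp := pdM_Hop_residual hdHM hpdM hh hc hcocycle p
    cases p with
    | zero =>
      rw [Nat.cast_zero, sub_zero] at hp
      exact hp.symm
    | succ q =>
      rw [Nat.cast_succ] at hp
      simp only [TotDM]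
      rw [hp, residual, sub_add_cancel]
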